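/- If s_{i_1}⋯s_{i_l} and s_{j_1}⋯s_{j_l} are two reduced expressions of the same permutation w ∈ S_κ (so l = l(w)), then T̃_{i_1}⋯T̃_{i_l} = T̃_{j_1}⋯T̃_{j_l} in H_κ; in particular the standard basis element T̃_w is well defined independently of the chosen reduced expression. -/

import Mathlib

open Polynomial

noncomputable section

/-- The adjacent transposition `s_{i+1}` (paper index `i+1`) in the symmetric group `S_{n+1}`. -/
def sσ (n : ℕ) (i : Fin n) : Equiv.Perm (Fin (n + 1)) :=
  Equiv.swap i.castSucc i.succ

/-- The Coxeter length of a permutation: the minimal length of an expression as a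
product of adjacent transpositions. -/
def len (n : ℕ) (w : Equiv.Perm (Fin (n + 1))) : ℕ :=
  sInf {l | ∃ L : List (Fin n), L.length = l ∧ (L.map (sσ n)).prod = w}

/-- The defining relations of the Hecke algebra over `ℤ[ℏ] = Polynomial ℤ`. -/
inductive HeckeRel (n : ℕ) :
    FreeAlgebra (Polynomial ℤ) (Fin n) → FreeAlgebra (Polynomial ℤ) (Fin n) → Prop
  | quad (i : Fin n) :
      HeckeRel n (FreeAlgebra.ι (Polynomial ℤ) i * FreeAlgebra.ι (Polynomial ℤ) i)
        (1 + (X : Polynomial ℤ) • FreeAlgebra.ι (Polynomial ℤ) i)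
  | comm (i j : Fin n) (h : (i : ℕ) + 1 < j ∨ (j : ℕ) + 1 < i) :
      HeckeRel n (FreeAlgebra.ι (Polynomial ℤ) i * FreeAlgebra.ι (Polynomial ℤ) j)
        (FreeAlgebra.ι (Polynomial ℤ) j * FreeAlgebra.ι (Polynomial ℤ) i)
  | braid (i j : Fin n) (h : (j : ℕ) = (i : ℕ) + 1) :
      HeckeRel n (FreeAlgebra.ι (Polynomial ℤ) i * FreeAlgebra.ι (Polynomial ℤ) j *
          FreeAlgebra.ι (Polynomial ℤ) i)
        (FreeAlgebra.ι (Polynomial ℤ) j * FreeAlgebra.ι (Polynomial ℤ) i *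
          FreeAlgebra.ι (Polynomial ℤ) j)

/-- The Hecke algebra `H_{n+1}` (with `n` generators) over `ℤ[ℏ]`. -/
abbrev Hecke (n : ℕ) := RingQuot (HeckeRel n)

/-- The generator `T̃_{i+1}` of the Hecke algebra. -/
def Tgen (n : ℕ) (i : Fin n) : Hecke n :=
  RingQuot.mkAlgHom (Polynomial ℤ) (HeckeRel n) (FreeAlgebra.ι (Polynomial ℤ) i)

/-- The standard basis element `T̃_w`, defined via a choice of reduced expression of `w`. -/
def Tstd (n : ℕ) (w : Equiv.Perm (Fin (n + 1))) : Hecke n :=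
  letI := Classical.propDecidable
  if h : ∃ L : List (Fin n), (L.map (sσ n)).prod = w ∧ L.length = len n w then
    ((Classical.choose h).map (Tgen n)).prod
  else 0

/-- The inversions of a permutation. -/
def inversions {n : ℕ} (v : Equiv.Perm (Fin (n + 1))) : Finset (Fin (n + 1) × Fin (n + 1)) :=
  Finset.univ.filter fun p => p.1 < p.2 ∧ v p.2 < v p.1

theorem mk_mem_inversions {n : ℕ} {v : Equiv.Perm (Fin (n + 1))} {a b : Fin (n + 1)} :
    (a, b) ∈ inversions v ↔ a < b ∧ v b < v a := by
  simp [inversions]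

/-- The number of inversions of a permutation. -/
def invCount {n : ℕ} (v : Equiv.Perm (Fin (n + 1))) : ℕ :=
  (inversions v).card

theorem sσ_mul_self (n : ℕ) (i : Fin n) : sσ n i * sσ n i = 1 := Equiv.swap_mul_self _ _

theorem sσ_mul_sσ_mul (n : ℕ) (i : Fin n) (w : Equiv.Perm (Fin (n + 1))) :
    sσ n i * (sσ n i * w) = w := by
  rw [← mul_assoc, sσ_mul_self, one_mul]

theorem sσ_inv (n : ℕ) (i : Fin n) : (sσ n i)⁻¹ = sσ n i := Equiv.swap_inv _ _

theorem sσ_apply_castSucc (n : ℕ) (i : Fin n) : sσ n i i.castSucc = i.succ :=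
  Equiv.swap_apply_left _ _

theorem sσ_apply_succ (n : ℕ) (i : Fin n) : sσ n i i.succ = i.castSucc :=
  Equiv.swap_apply_right _ _

theorem sσ_lt_sσ_iff {n : ℕ} {i : Fin n} {a b : Fin (n + 1)}
    (h : ¬(a = i.castSucc ∧ b = i.succ)) (h' : ¬(a = i.succ ∧ b = i.castSucc)) :
    sσ n i a < sσ n i b ↔ a < b := by
  simp only [sσ, Equiv.swap_apply_def]
  simp only [Fin.ext_iff, Fin.lt_def, Fin.val_castSucc, Fin.val_succ] at *
  split_ifs <;> simp only [Fin.val_castSucc, Fin.val_succ] <;> omega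

theorem mk_mem_map_sσ_iff {n : ℕ} {i : Fin n} {s : Finset (Fin (n + 1) × Fin (n + 1))}
    {a b : Fin (n + 1)} :
    (a, b) ∈ s.map ((sσ n i).prodCongr (sσ n i)).toEmbedding ↔ (sσ n i a, sσ n i b) ∈ s := by
  rw [Finset.mem_map_equiv]
  have : (sσ n i).symm = sσ n i := sσ_inv n i
  simp [Equiv.prodCongr_symm, this]

theorem invCount_mul_sσ_of_lt {n : ℕ} {v : Equiv.Perm (Fin (n + 1))} {i : Fin n}
    (h : v i.castSucc < v i.succ) : invCount (v * sσ n i) = invCount v + 1 := by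
  unfold invCount
  have hi : i.castSucc < i.succ := Fin.castSucc_lt_succ
  rw [← Finset.card_map ((sσ n i).prodCongr (sσ n i)).toEmbedding (s := inversions v),
    ← Finset.card_insert_of_notMem (a := (i.castSucc, i.succ))]
  · congr 1
    ext ⟨a, b⟩
    rw [Finset.mem_insert, mk_mem_map_sσ_iff, mk_mem_inversions, mk_mem_inversions,
      Equiv.Perm.mul_apply, Equiv.Perm.mul_apply, Prod.mk.injEq]
    by_cases h₁ : a = i.castSucc ∧ b = i.succ
    · obtain ⟨rfl, rfl⟩ := h₁
      simp [sσ_apply_castSucc, sσ_apply_succ, h]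
    by_cases h₂ : a = i.succ ∧ b = i.castSucc
    · obtain ⟨rfl, rfl⟩ := h₂
      simp [sσ_apply_castSucc, sσ_apply_succ, h.le, hi.ne]
    rw [sσ_lt_sσ_iff h₁ h₂]
    simp [h₁]
  · rw [mk_mem_map_sσ_iff, mk_mem_inversions, sσ_apply_castSucc, sσ_apply_succ]
    exact fun h' => h'.1.asymm hi

theorem invCount_mul_sσ_of_gt {n : ℕ} {v : Equiv.Perm (Fin (n + 1))} {i : Fin n}
    (h : v i.succ < v i.castSucc) : invCount (v * sσ n i) + 1 = invCount v := by
  have := invCount_mul_sσ_of_lt (v := v * sσ n i) (i := i)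
    (by simpa [sσ_apply_castSucc, sσ_apply_succ] using h)
  rw [← this, mul_assoc, sσ_mul_self, mul_one]

theorem invCount_one (n : ℕ) : invCount (1 : Equiv.Perm (Fin (n + 1))) = 0 := by
  rw [invCount, Finset.card_eq_zero, Finset.eq_empty_iff_forall_notMem]
  rintro ⟨a, b⟩ h
  rw [mk_mem_inversions] at h
  exact h.1.asymm h.2

/-- `i` is a left descent of `w` when `w⁻¹` reverses `i` and `i + 1`. -/
def IsDescent {n : ℕ} (w : Equiv.Perm (Fin (n + 1))) (i : Fin n) : Prop :=
  w⁻¹ i.succ < w⁻¹ i.castSucc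

theorem IsDescent.invCount_inv {n : ℕ} {w : Equiv.Perm (Fin (n + 1))} {i : Fin n}
    (h : IsDescent w i) : invCount (sσ n i * w)⁻¹ + 1 = invCount w⁻¹ := by
  rw [mul_inv_rev, sσ_inv]
  exact invCount_mul_sσ_of_gt h

theorem invCount_inv_of_not_isDescent {n : ℕ} {w : Equiv.Perm (Fin (n + 1))} {i : Fin n}
    (h : ¬IsDescent w i) : invCount (sσ n i * w)⁻¹ = invCount w⁻¹ + 1 := by
  rw [mul_inv_rev, sσ_inv]
  refine invCount_mul_sσ_of_lt (lt_of_le_of_ne (not_lt.1 h) fun e => ?_)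
  simpa [Fin.ext_iff] using w⁻¹.injective e

theorem exists_isDescent {n : ℕ} {w : Equiv.Perm (Fin (n + 1))} (hw : w ≠ 1) :
    ∃ i, IsDescent w i := by
  by_contra! h
  apply hw
  have hm : StrictMono (w⁻¹ : Equiv.Perm (Fin (n + 1))) :=
    Fin.strictMono_iff_lt_succ.2 fun i => lt_of_le_of_ne (not_lt.1 (h i)) fun e => by
      simpa [Fin.ext_iff] using w⁻¹.injective e
  have hid := (hm.range_inj strictMono_id).1 (by rw [Equiv.range_eq_univ, Set.range_id])
  exact inv_eq_one.1 (Equiv.ext fun a => congrFun hid a)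

theorem exists_word_length_eq_invCount (n : ℕ) (w : Equiv.Perm (Fin (n + 1))) :
    ∃ L : List (Fin n), (L.map (sσ n)).prod = w ∧ L.length = invCount w⁻¹ := by
  induction hk : invCount w⁻¹ generalizing w with
  | zero =>
    by_cases hw : w = 1
    · exact ⟨[], by simp [hw]⟩
    · obtain ⟨i, hi⟩ := exists_isDescent hw
      have := hi.invCount_inv
      omega
  | succ k ih =>
    have hw : w ≠ 1 := by
      rintro rfl
      simp [invCount_one] at hk
    obtain ⟨i, hi⟩ := exists_isDescent hw
    have := hi.invCount_inv
    obtain ⟨L, hL, hl⟩ := ih (sσ n i * w) (by omega)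
    exact ⟨i :: L, by simp [hL, sσ_mul_sσ_mul], by simp [hl]⟩

theorem invCount_inv_prod_le (n : ℕ) (L : List (Fin n)) :
    invCount ((L.map (sσ n)).prod)⁻¹ ≤ L.length := by
  induction L with
  | nil => simp [invCount_one]
  | cons i L ih =>
    rw [List.map_cons, List.prod_cons, List.length_cons]
    by_cases h : IsDescent (L.map (sσ n)).prod i
    · have := h.invCount_inv
      omega
    · have := invCount_inv_of_not_isDescent h
      omega

theorem len_eq_invCount_inv (n : ℕ) (w : Equiv.Perm (Fin (n + 1))) :
    len n w = invCount w⁻¹ := by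
  obtain ⟨L, hL, hl⟩ := exists_word_length_eq_invCount n w
  apply le_antisymm
  · exact Nat.sInf_le ⟨L, hl, hL⟩
  · refine le_csInf ⟨_, L, hl, hL⟩ ?_
    rintro _ ⟨L', rfl, rfl⟩
    exact invCount_inv_prod_le n L'

/-- A word in the adjacent transpositions of minimal length among those with the same product. -/
def IsReducedWord {n : ℕ} (L : List (Fin n)) : Prop :=
  L.length = invCount ((L.map (sσ n)).prod)⁻¹

theorem IsReducedWord.tail {n : ℕ} {i : Fin n} {L : List (Fin n)} (h : IsReducedWord (i :: L)) :
    IsReducedWord L := by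
  have hle := invCount_inv_prod_le n L
  rw [IsReducedWord, List.map_cons, List.prod_cons, List.length_cons] at h
  by_cases hd : IsDescent (L.map (sσ n)).prod i
  · have := hd.invCount_inv
    omega
  · have := invCount_inv_of_not_isDescent hd
    rw [IsReducedWord]
    omega

theorem IsReducedWord.isDescent {n : ℕ} {i : Fin n} {L : List (Fin n)}
    (h : IsReducedWord (i :: L)) : IsDescent ((i :: L).map (sσ n)).prod i := by
  by_contra hd
  have h₁ := invCount_inv_of_not_isDescent hd
  have h₂ := h.tail
  rw [List.map_cons, List.prod_cons, sσ_mul_sσ_mul] at h₁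
  rw [IsReducedWord, List.map_cons, List.prod_cons, List.length_cons] at h
  rw [IsReducedWord] at h₂
  omega

theorem sσ_apply_of_ne {n : ℕ} {i : Fin n} {a : Fin (n + 1)} (h₁ : (a : ℕ) ≠ i)
    (h₂ : (a : ℕ) ≠ i + 1) : sσ n i a = a :=
  Equiv.swap_apply_of_ne_of_ne (by simpa [Fin.ext_iff] using h₁) (by simpa [Fin.ext_iff] using h₂)

theorem sσ_comm {n : ℕ} {i j : Fin n} (h : (i : ℕ) + 1 < j) :
    sσ n i * sσ n j = sσ n j * sσ n i := by
  ext a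
  simp only [Equiv.Perm.mul_apply, sσ, Equiv.swap_apply_def]
  simp only [Fin.ext_iff]
  split_ifs <;> simp only [Fin.val_castSucc, Fin.val_succ] at * <;> omega

theorem sσ_braid {n : ℕ} {i j : Fin n} (h : (j : ℕ) = i + 1) :
    sσ n i * sσ n j * sσ n i = sσ n j * sσ n i * sσ n j := by
  have hij : j.castSucc = i.succ := by simp [Fin.ext_iff, h]
  have h₁ : i.castSucc ≠ i.succ := by simp [Fin.ext_iff]
  have h₂ : i.castSucc ≠ j.succ := by simp [Fin.ext_iff]; omega
  have h₃ : i.succ ≠ j.succ := by simp [Fin.ext_iff]; omega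
  simp only [sσ, hij]
  rw [Equiv.swap_mul_swap_mul_swap h₁ h₂, Equiv.swap_comm i.succ j.succ,
    Equiv.swap_comm i.castSucc i.succ, Equiv.swap_mul_swap_mul_swap h₃.symm h₂.symm,
    Equiv.swap_comm]

/-- Two commuting descents can be split off simultaneously. -/
theorem exists_word_of_isDescent_of_comm {n : ℕ} {w : Equiv.Perm (Fin (n + 1))} {i j : Fin n}
    (hij : (i : ℕ) + 1 < j) (hi : IsDescent w i) (hj : IsDescent w j) :
    ∃ U : List (Fin n), ((i :: j :: U).map (sσ n)).prod = w ∧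
      U.length + 2 = invCount w⁻¹ := by
  have hj' : IsDescent (sσ n i * w) j := by
    have e₁ : sσ n i j.castSucc = j.castSucc := sσ_apply_of_ne (by simp; omega) (by simp; omega)
    have e₂ : sσ n i j.succ = j.succ := sσ_apply_of_ne (by simp; omega) (by simp; omega)
    simpa only [IsDescent, mul_inv_rev, sσ_inv, Equiv.Perm.mul_apply, e₁, e₂] using hj
  obtain ⟨U, hU, hl⟩ := exists_word_length_eq_invCount n (sσ n j * (sσ n i * w))
  have h₁ := hi.invCount_inv
  have h₂ := hj'.invCount_inv
  exact ⟨U, by simp [hU, sσ_mul_sσ_mul], by omega⟩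

/-- If two adjacent simple transpositions are descents, so is the longest element they generate. -/
theorem exists_word_of_isDescent_of_braid {n : ℕ} {w : Equiv.Perm (Fin (n + 1))} {i j : Fin n}
    (hij : (j : ℕ) = i + 1) (hi : IsDescent w i) (hj : IsDescent w j) :
    ∃ U : List (Fin n), ((i :: j :: i :: U).map (sσ n)).prod = w ∧
      U.length + 3 = invCount w⁻¹ := by
  have e : j.castSucc = i.succ := by simp [Fin.ext_iff, hij]
  have e₁ : sσ n i j.succ = j.succ := sσ_apply_of_ne (by simp; omega) (by simp; omega)
  have e₂ : sσ n j i.castSucc = i.castSucc := sσ_apply_of_ne (by simp; omega) (by simp; omega)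
  have e₃ : sσ n j i.succ = j.succ := by rw [← e, sσ_apply_castSucc]
  have hj' : IsDescent (sσ n i * w) j := by
    simp only [IsDescent, mul_inv_rev, sσ_inv, Equiv.Perm.mul_apply, e, e₁, sσ_apply_succ] at *
    exact hj.trans hi
  have hi' : IsDescent (sσ n j * (sσ n i * w)) i := by
    simp only [IsDescent, mul_inv_rev, sσ_inv, Equiv.Perm.mul_apply, e, e₁, e₂, e₃,
      sσ_apply_castSucc] at *
    exact hj
  obtain ⟨U, hU, hl⟩ := exists_word_length_eq_invCount n (sσ n i * (sσ n j * (sσ n i * w)))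
  have h₁ := hi.invCount_inv
  have h₂ := hj'.invCount_inv
  have h₃ := hi'.invCount_inv
  exact ⟨U, by simp [hU, sσ_mul_sσ_mul], by omega⟩

/-- **Matsumoto's theorem** for the symmetric group: a family in a monoid satisfying the braid
relations has the same product along any two reduced words of the same permutation. -/
theorem prod_map_eq_of_isReducedWord {n : ℕ} {M : Type*} [Monoid M] {f : Fin n → M}
    (hcomm : ∀ i j : Fin n, (i : ℕ) + 1 < j → f i * f j = f j * f i)
    (hbraid : ∀ i j : Fin n, (j : ℕ) = i + 1 → f i * f j * f i = f j * f i * f j)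
    {L₁ L₂ : List (Fin n)} (h₁ : IsReducedWord L₁) (h₂ : IsReducedWord L₂)
    (h : (L₁.map (sσ n)).prod = (L₂.map (sσ n)).prod) :
    (L₁.map f).prod = (L₂.map f).prod := by
  induction hk : L₁.length using Nat.strong_induction_on generalizing L₁ L₂ with
  | _ k ih =>
  have hlen : L₁.length = L₂.length := by rw [h₁, h₂, h]
  match L₁, L₂ with
  | [], [] => rfl
  | [], _ :: _ => simp at hlen
  | _ :: _, [] => simp at hlen
  | i :: L₁, j :: L₂ =>
    -- words with a common first letter
    have head : ∀ {a : Fin n} {P Q : List (Fin n)}, P.length + 1 = k → IsReducedWord (a :: P) →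
        IsReducedWord (a :: Q) → ((a :: P).map (sσ n)).prod = ((a :: Q).map (sσ n)).prod →
        ((a :: P).map f).prod = ((a :: Q).map f).prod := by
      intro a P Q hP hrP hrQ hPQ
      rw [List.map_cons, List.map_cons, List.prod_cons, List.prod_cons,
        ih P.length (by omega) hrP.tail hrQ.tail (by simpa using hPQ) rfl]
    have reduced : ∀ {P : List (Fin n)}, P.length = k →
        (P.map (sσ n)).prod = ((i :: L₁).map (sσ n)).prod → IsReducedWord P := by
      intro P hP hPw
      rw [IsReducedWord, hP, hPw, ← hk, h₁]
    have hk' : invCount (((i :: L₁).map (sσ n)).prod)⁻¹ = k := by rw [← hk, h₁]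
    wlog hij : i ≤ j generalizing i j L₁ L₂
    · refine (this j L₂ i L₁ h₂ h₁ h.symm (by rw [← hlen, hk]) hlen.symm
        (fun hP hPw => reduced hP (hPw.trans h.symm)) (by rw [← h, hk']) (by omega)).symm
    rcases hij.eq_or_lt with rfl | hij
    · exact head (by simpa using hk) h₁ h₂ h
    have di := h₁.isDescent
    have dj := h₂.isDescent
    rw [← h] at dj
    rw [Fin.lt_def] at hij
    by_cases hadj : (j : ℕ) = i + 1
    · obtain ⟨U, hU, hl⟩ := exists_word_of_isDescent_of_braid hadj di dj
      have hU' : ((j :: i :: j :: U).map (sσ n)).prod = ((i :: L₁).map (sσ n)).prod := by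
        rw [← hU]
        simpa [mul_assoc] using
          congrArg (· * (U.map (sσ n)).prod) (sσ_braid hadj).symm
      calc _ = ((i :: j :: i :: U).map f).prod :=
            head (by simpa using hk) h₁ (reduced (by simp; omega) hU) hU.symm
        _ = ((j :: i :: j :: U).map f).prod := by
            simpa [mul_assoc] using congrArg (· * (U.map f).prod) (hbraid i j hadj)
        _ = _ := head (by simp; omega) (reduced (by simp; omega) hU') h₂ (hU'.trans h)
    · have hfar : (i : ℕ) + 1 < j := by omega
      obtain ⟨U, hU, hl⟩ := exists_word_of_isDescent_of_comm hfar di dj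
      have hU' : ((j :: i :: U).map (sσ n)).prod = ((i :: L₁).map (sσ n)).prod := by
        rw [← hU]
        simpa [mul_assoc] using
          congrArg (· * (U.map (sσ n)).prod) (sσ_comm hfar).symm
      calc _ = ((i :: j :: U).map f).prod :=
            head (by simpa using hk) h₁ (reduced (by simp; omega) hU) hU.symm
        _ = ((j :: i :: U).map f).prod := by
            simpa [mul_assoc] using congrArg (· * (U.map f).prod) (hcomm i j hfar)
        _ = _ := head (by simp; omega) (reduced (by simp; omega) hU') h₂ (hU'.trans h)

theorem Tgen_comm {n : ℕ} (i j : Fin n) (h : (i : ℕ) + 1 < j) :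
    Tgen n i * Tgen n j = Tgen n j * Tgen n i := by
  simpa only [Tgen, map_mul] using RingQuot.mkAlgHom_rel (Polynomial ℤ) (HeckeRel.comm i j (.inl h))

theorem Tgen_braid {n : ℕ} (i j : Fin n) (h : (j : ℕ) = i + 1) :
    Tgen n i * Tgen n j * Tgen n i = Tgen n j * Tgen n i * Tgen n j := by
  simpa only [Tgen, map_mul] using RingQuot.mkAlgHom_rel (Polynomial ℤ) (HeckeRel.braid i j h)

theorem prod_map_Tgen_eq {n : ℕ} {w : Equiv.Perm (Fin (n + 1))} {L₁ L₂ : List (Fin n)}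
    (h₁ : (L₁.map (sσ n)).prod = w) (hl₁ : L₁.length = len n w)
    (h₂ : (L₂.map (sσ n)).prod = w) (hl₂ : L₂.length = len n w) :
    (L₁.map (Tgen n)).prod = (L₂.map (Tgen n)).prod :=
  prod_map_eq_of_isReducedWord Tgen_comm Tgen_braid
    (by rw [IsReducedWord, h₁, hl₁, len_eq_invCount_inv])
    (by rw [IsReducedWord, h₂, hl₂, len_eq_invCount_inv]) (h₁.trans h₂.symm)

/-- Two reduced expressions of the same permutation give the same product of Hecke
generators; in particular `T̃_w` is well defined. -/
theorem stmt1 (n : ℕ) (w : Equiv.Perm (Fin (n + 1))) (L₁ L₂ : List (Fin n))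
    (h₁ : (L₁.map (sσ n)).prod = w) (hl₁ : L₁.length = len n w)
    (h₂ : (L₂.map (sσ n)).prod = w) (hl₂ : L₂.length = len n w) :
    (L₁.map (Tgen n)).prod = (L₂.map (Tgen n)).prod ∧
    Tstd n w = (L₁.map (Tgen n)).prod := by
  refine ⟨prod_map_Tgen_eq h₁ hl₁ h₂ hl₂, ?_⟩
  have h : ∃ L : List (Fin n), (L.map (sσ n)).prod = w ∧ L.length = len n w := ⟨L₁, h₁, hl₁⟩
  rw [Tstd, dif_pos h]
  exact prod_map_Tgen_eq h.choose_spec.1 h.choose_spec.2 h₁ hl₁
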